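/- arXiv:2501.09685 — 4 statements merged into one kernel-verified Lean document; each statement's English description precedes it below -/
import Mathlib

section
/- Under the pre-trained chain and soft value functions defined in the context, let μ* be the tilted initial distribution μ*(dx) = μ(dx)·exp(v_T(x)/α)/∫ exp(v_T(x')/α) μ(dx'), and let P*₀ be the law of x₀ under the chain x_T ∼ μ*, x_{t−1} ∼ κ*_t(x_t, ·) for t = T, …, 1. Let P₀^pre be the law of x₀ under the pre-trained chain x_T ∼ μ, x_{t−1} ∼ κ_t(x_t, ·). Then P*₀(dx) = exp(r(x)/α)·P₀^pre(dx) / ∫ exp(r(x')/α) P₀^pre(dx'), i.e. the soft optimal policies induce exactly the reward-tilted target distribution. -/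
open MeasureTheory ProbabilityTheory

/-- The composition of the denoising kernels `κ t, κ (t-1), …, κ 1`:
`preChain κ t x` is the law of `x₀` when the chain is started at `x_t = x`. -/
noncomputable def preChain {X : Type*} [MeasurableSpace X] (κ : ℕ → Kernel X X) :
    ℕ → Kernel X X
  | 0 => Kernel.id
  | (t + 1) => (preChain κ t) ∘ₖ (κ (t + 1))

theorem aux_tilt {X : Type*} [MeasurableSpace X]
    (μ : Measure X) [IsProbabilityMeasure μ]
    (K : Kernel X X) [IsMarkovKernel K] (f g : X → ℝ) (hf : Measurable f) (C : ℝ)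
    (hfC : ∀ x, |f x| ≤ C)
    (hg : ∀ x, Real.exp (g x) = ∫ y, Real.exp (f y) ∂(K x))
    (L : Kernel X X) (hL : ∀ x, L x = (K x).tilted f) :
    (μ.tilted g).bind (fun x => L x) = (μ.bind (fun x => K x)).tilted f := by
  have hKm : Measurable (fun x => K x) := K.measurable
  haveI : IsProbabilityMeasure (μ.bind (fun x => K x)) :=
    inferInstanceAs (IsProbabilityMeasure (μ.bind K))
  have hint : ∀ ν : Measure X, IsProbabilityMeasure ν →
      Integrable (fun x => Real.exp (f x)) ν := by
    intro ν _
    refine Integrable.of_bound (C := Real.exp C) (by fun_prop) (ae_of_all _ fun x => ?_)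
    rw [Real.norm_eq_abs, abs_of_pos (Real.exp_pos _)]
    exact Real.exp_le_exp.2 (le_trans (le_abs_self _) (hfC x))
  have hZ : ∫ y, Real.exp (f y) ∂(μ.bind (fun x => K x)) = ∫ x, Real.exp (g x) ∂μ := by
    simp_rw [hg]
    have h := Kernel.integral_comp (η := K) (κ := Kernel.const Unit μ) (a := ())
      (f := fun y => Real.exp (f y)) (hint _ inferInstance)
    rw [Kernel.comp_apply, Kernel.const_apply] at h
    exact h
  have hgm : Measurable (fun x => Real.exp (g x)) := by
    simp_rw [hg]
    exact (StronglyMeasurable.integral_kernel (κ := K)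
      (f := fun y => Real.exp (f y)) (by fun_prop)).measurable
  ext s hs
  rw [Measure.bind_apply hs L.measurable.aemeasurable, tilted_apply' _ _ hs,
    lintegral_tilted, hZ, ← lintegral_indicator hs,
    Measure.lintegral_bind hKm.aemeasurable (by
      refine (Measurable.indicator ?_ hs).aemeasurable
      fun_prop)]
  refine lintegral_congr fun x => ?_
  rw [hL, tilted_apply' _ _ hs, lintegral_indicator hs, ← hg x,
    ← lintegral_const_mul _ (by fun_prop)]
  refine lintegral_congr fun y => ?_
  rw [← ENNReal.ofReal_mul (by positivity)]
  congr 1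
  have := (Real.exp_pos (g x)).ne'
  field_simp

theorem aux_markov {X : Type*} [MeasurableSpace X] (κ : ℕ → Kernel X X)
    [∀ t, IsMarkovKernel (κ t)] (t : ℕ) : IsMarkovKernel (preChain κ t) := by
  induction t with
  | zero => rw [preChain]; infer_instance
  | succ t ih => rw [preChain]; infer_instance

/-- **Soft optimal policies induce the reward-tilted target distribution.**
With the tilted initial distribution `μ* = μ tilted by v_T/α` and the soft optimal
policies `κ*_t = κ_t tilted by v_{t-1}/α`, the law of `x₀` under the starred chain is
the reward-tilted pre-trained law of `x₀`:
`P*₀(dx) = exp(r(x)/α) P₀^pre(dx) / ∫ exp(r/α) dP₀^pre`. -/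
theorem soft_optimal_policies_induce_tilted_target
    {X : Type*} [MeasurableSpace X]
    (T : ℕ) (hT : 1 ≤ T)
    (μ : Measure X) [IsProbabilityMeasure μ]
    (κ : ℕ → Kernel X X) [∀ t, IsMarkovKernel (κ t)]
    (r : X → ℝ) (hr : Measurable r) (C : ℝ) (hrC : ∀ x, |r x| ≤ C)
    (α : ℝ) (hα : 0 < α)
    (v : ℕ → X → ℝ)
    (hv : ∀ t x, Real.exp (v t x / α) = ∫ y, Real.exp (r y / α) ∂(preChain κ t x))
    (κStar : ℕ → Kernel X X)
    (hstar : ∀ t, 1 ≤ t → t ≤ T → ∀ x : X,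
      (κStar t) x = ((κ t) x).tilted (fun y => v (t - 1) y / α)) :
    (μ.tilted (fun x => v T x / α)).bind (fun x => (preChain κStar T) x)
      = (μ.bind (fun x => (preChain κ T) x)).tilted (fun x => r x / α) := by
  have hm := aux_markov κ
  have hrm : Measurable (fun x => r x / α) := by fun_prop
  have hb : ∀ x, |r x / α| ≤ C / α := by
    intro x
    rw [abs_div, abs_of_pos hα]
    exact div_le_div_of_nonneg_right (hrC x) hα.le
  have key : ∀ t, t ≤ T → ∀ x,
      preChain κStar t x = (preChain κ t x).tilted (fun x => r x / α) := by
    intro t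
    induction t with
    | zero =>
      intro _ x
      ext s hs
      rw [tilted_apply' _ _ hs]
      simp only [preChain, Kernel.id_apply]
      rw [integral_dirac' _ _ (by exact (Real.measurable_exp.comp hrm).stronglyMeasurable),
        ← lintegral_indicator hs, lintegral_dirac' _ (by
          refine Measurable.indicator ?_ hs
          fun_prop), Measure.dirac_apply' _ hs]
      by_cases hx : x ∈ s <;> simp [hx]
    | succ t ih =>
      intro ht x
      have := aux_tilt (κ (t + 1) x) (preChain κ t) (fun x => r x / α) (fun x => v t x / α)
        hrm (C / α) hb (hv t) (preChain κStar t) (ih (by omega))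
      have h2 := hstar (t + 1) (by omega) ht x
      rw [Nat.add_sub_cancel] at h2
      rw [preChain, preChain, Kernel.comp_apply, Kernel.comp_apply, h2]
      exact this
  exact aux_tilt μ (preChain κ T) (fun x => r x / α) (fun x => v T x / α)
    hrm (C / α) hb (hv T) (preChain κStar T) (key T le_rfl)
end

section
/- Under the pre-trained chain, soft value functions, and soft optimal policies defined in the context, fix t with 1 ≤ t ≤ T, x ∈ X, and a Markov kernel π with π(x, ·) absolutely continuous with respect to κ_t(x, ·). Then π(x, ·) = κ*_t(x, ·) if and only if the path-consistency residual vanishes, i.e. log (dπ(x, ·)/dκ_t(x, ·))(y) − v_{t−1}(y)/α + v_t(x)/α = 0 for κ_t(x, ·)-almost every y. -/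
open MeasureTheory ProbabilityTheory

lemma preChain_markov {X : Type*} [MeasurableSpace X] (κ : ℕ → Kernel X X)
    [∀ t, IsMarkovKernel (κ t)] : ∀ n, IsMarkovKernel (preChain κ n)
  | 0 => by unfold preChain; infer_instance
  | (n + 1) => by
    have := preChain_markov κ n
    unfold preChain
    infer_instance

lemma core {X : Type*} [MeasurableSpace X] (m p : Measure X) [IsProbabilityMeasure m]
    [IsProbabilityMeasure p] (f : X → ℝ) (hfm : Measurable f)
    (hfi : Integrable (fun y => Real.exp (f y)) m) (c : ℝ)
    (hE : Real.exp c = ∫ y, Real.exp (f y) ∂m) (hac : p ≪ m) :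
    p = m.tilted f ↔ ∀ᵐ y ∂m, llr p m y - f y + c = 0 := by
  constructor
  · rintro rfl
    filter_upwards [log_rnDeriv_tilted_left_self hfi] with y hy
    rw [llr, hy, ← hE, Real.log_exp]
    ring
  · intro h
    have hgi : Integrable (fun y => Real.exp (f y) / Real.exp c) m := hfi.div_const _
    have hle : (fun y => (p.rnDeriv m y).toReal) ≤ᵐ[m] fun y => Real.exp (f y) / Real.exp c := by
      filter_upwards [h] with y hy
      rcases (ENNReal.toReal_nonneg (a := p.rnDeriv m y)).eq_or_lt with h0 | h0
      · rw [← h0]; positivity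
      · rw [← Real.exp_sub, ← Real.exp_log h0]
        simp only [llr] at hy
        exact Real.exp_le_exp.mpr (by linarith)
    have heq := (integral_eq_iff_of_ae_le Measure.integrable_toReal_rnDeriv hgi hle).mp (by
      rw [Measure.integral_toReal_rnDeriv hac, integral_div, ← hE,
        div_self (Real.exp_pos c).ne']
      simp)
    rw [← Measure.withDensity_rnDeriv_eq p m hac, Measure.tilted]
    apply withDensity_congr_ae
    filter_upwards [heq, p.rnDeriv_lt_top m] with y hy hy'
    rw [← hE, ← hy, ENNReal.ofReal_toReal hy'.ne]

/-- **Path-consistency characterization of the soft optimal policy.**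
For `1 ≤ t ≤ T`, `x ∈ X` and a Markov kernel `π` with `π(x,·) ≪ κ_t(x,·)`:
`π(x,·) = κ*_t(x,·)` iff the path-consistency residual
`log (dπ(x,·)/dκ_t(x,·))(y) − v_{t-1}(y)/α + v_t(x)/α` vanishes `κ_t(x,·)`-a.e. -/
theorem path_consistency_characterizes_soft_optimal_policy
    {X : Type*} [MeasurableSpace X]
    (T : ℕ) (hT : 1 ≤ T)
    (μ : Measure X) [IsProbabilityMeasure μ]
    (κ : ℕ → Kernel X X) [∀ t, IsMarkovKernel (κ t)]
    (r : X → ℝ) (hr : Measurable r) (C : ℝ) (hrC : ∀ x, |r x| ≤ C)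
    (α : ℝ) (hα : 0 < α)
    (v : ℕ → X → ℝ)
    (hv : ∀ t x, Real.exp (v t x / α) = ∫ y, Real.exp (r y / α) ∂(preChain κ t x))
    (κStar : ℕ → Kernel X X)
    (hstar : ∀ t, 1 ≤ t → t ≤ T → ∀ x : X,
      (κStar t) x = ((κ t) x).tilted (fun y => v (t - 1) y / α))
    (t : ℕ) (ht1 : 1 ≤ t) (htT : t ≤ T) (x : X)
    (π : Kernel X X) [IsMarkovKernel π]
    (hac : π x ≪ (κ t) x) :
    π x = (κStar t) x ↔
      ∀ᵐ y ∂((κ t) x), llr (π x) ((κ t) x) y - v (t - 1) y / α + v t x / α = 0 := by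
  obtain ⟨s, rfl⟩ : ∃ s, t = s + 1 := ⟨t - 1, by omega⟩
  rw [hstar _ ht1 htT x]
  simp only [Nat.add_sub_cancel]
  have hM : ∀ n, IsMarkovKernel (preChain κ n) := preChain_markov κ
  have hem : Measurable (fun y => Real.exp (r y / α)) := by fun_prop
  have heb : ∀ y, ‖Real.exp (r y / α)‖ ≤ Real.exp (C / α) := by
    intro y
    rw [Real.norm_eq_abs, abs_of_pos (Real.exp_pos _)]
    have := (abs_le.mp (hrC y)).2
    gcongr
  have hint : ∀ (ν : Measure X) [IsProbabilityMeasure ν],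
      Integrable (fun y => Real.exp (r y / α)) ν := fun ν _ =>
    Integrable.of_bound hem.aestronglyMeasurable _ (Filter.Eventually.of_forall heb)
  have hE : Real.exp (v (s + 1) x / α) = ∫ y, Real.exp (v s y / α) ∂(κ (s + 1) x) := by
    rw [hv]
    simp_rw [hv s]
    have : IsMarkovKernel (preChain κ s ∘ₖ κ (s + 1)) := hM (s + 1)
    exact Kernel.integral_comp (hint ((preChain κ s ∘ₖ κ (s + 1)) x))
  have hfm : Measurable (fun y => v s y / α) := by
    have h1 : (fun y => v s y / α)
        = fun y => Real.log (∫ z, Real.exp (r z / α) ∂(preChain κ s y)) := by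
      funext y
      rw [← hv, Real.log_exp]
    rw [h1]
    exact Real.measurable_log.comp
      (hem.stronglyMeasurable.integral_kernel (κ := preChain κ s)).measurable
  have hfi : Integrable (fun y => Real.exp (v s y / α)) (κ (s + 1) x) := by
    by_contra h
    rw [integral_undef h] at hE
    exact (Real.exp_pos _).ne' hE
  exact core (κ (s + 1) x) (π x) (fun y => v s y / α) hfm hfi _ hE hac
end

section
/- Under the CTMC context, define the tilted (Doob-transformed) generators Q*(t) by Q*(t)_{y,x} = Q(t)_{y,x}·h_t(y)/h_t(x) for y ≠ x and Q*(t)_{x,x} = −Σ_{y≠x} Q*(t)_{y,x}. Fix an initial state z₀ ∈ S, let e_{z₀} be the corresponding standard basis probability vector, and let q* : [0,T] → ℝ^S solve the linear ODE d q*_t/dt = Q*(t) q*_t with q*_0 = e_{z₀}. Then the terminal distribution is the reward-tilted pre-trained terminal distribution: for every y ∈ S, q*_T(y) = exp(r(y))·P(0,T)_{y,z₀} / Σ_{y'} exp(r(y'))·P(0,T)_{y',z₀}. -/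
open Matrix

theorem aux_unique {S : Type*} [Fintype S] [DecidableEq S] (T : ℝ)
    (Q : ℝ → Matrix S S ℝ)
    (hQcont : ∀ y x, ContinuousOn (fun t => Q t y x) (Set.Icc 0 T))
    (a b : ℝ) (ha : 0 ≤ a) (hb : b ≤ T) (f g : ℝ → S → ℝ)
    (hf : ∀ t ∈ Set.Icc a b, HasDerivWithinAt f ((Q t).mulVec (f t)) (Set.Icc a b) t)
    (hg : ∀ t ∈ Set.Icc a b, HasDerivWithinAt g ((Q t).mulVec (g t)) (Set.Icc a b) t)
    (h0 : f a = g a ∨ f b = g b) : ∀ t ∈ Set.Icc a b, f t = g t := by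
  have hc : ContinuousOn (fun t => ∑ y, ∑ x, |Q t y x|) (Set.Icc 0 T) := by
    refine continuousOn_finsetSum _ fun y _ => continuousOn_finsetSum _ fun x _ => (hQcont y x).abs
  obtain ⟨C, hC⟩ := isCompact_Icc.exists_bound_of_continuousOn hc
  have hL : ∀ t ∈ Set.Icc a b, LipschitzOnWith (Real.toNNReal C) (fun v => (Q t).mulVec v) Set.univ := by
    intro t ht
    have hCt := hC t ⟨ha.trans ht.1, ht.2.trans hb⟩
    rw [Real.norm_eq_abs] at hCt
    have hCt' := (le_abs_self _).trans hCt
    refine LipschitzOnWith.of_dist_le_mul fun u _ v _ => ?_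
    rw [dist_eq_norm, dist_eq_norm, ← Matrix.mulVec_sub, Real.coe_toNNReal _ ((abs_nonneg _).trans hCt)]
    have hC0 := (abs_nonneg _).trans hCt
    rw [pi_norm_le_iff_of_nonneg (by positivity)]
    intro y
    calc ‖(Q t).mulVec (u - v) y‖ ≤ ∑ x, |Q t y x| * ‖u - v‖ := by
          refine (norm_sum_le _ _).trans (Finset.sum_le_sum fun x _ => ?_)
          rw [norm_mul, Real.norm_eq_abs]
          exact mul_le_mul_of_nonneg_left (norm_le_pi_norm (u - v) x) (abs_nonneg _)
      _ = (∑ x, |Q t y x|) * ‖u - v‖ := by rw [Finset.sum_mul]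
      _ ≤ C * ‖u - v‖ := by
          refine mul_le_mul_of_nonneg_right (le_trans ?_ hCt') (norm_nonneg _)
          exact Finset.single_le_sum (f := fun y => ∑ x, |Q t y x|)
            (fun i _ => Finset.sum_nonneg fun j _ => abs_nonneg _) (Finset.mem_univ y)
  have cf : ContinuousOn f (Set.Icc a b) := fun t ht => (hf t ht).continuousWithinAt
  have cg : ContinuousOn g (Set.Icc a b) := fun t ht => (hg t ht).continuousWithinAt
  have dR : ∀ (k : ℝ → S → ℝ) (k' : S → ℝ) (t : ℝ), t ∈ Set.Ico a b →
      HasDerivWithinAt k k' (Set.Icc a b) t → HasDerivWithinAt k k' (Set.Ici t) t := by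
    intro k k' t ht hk
    exact hk.mono_of_mem_nhdsWithin (Filter.mem_of_superset (Icc_mem_nhdsGE ht.2)
      (Set.Icc_subset_Icc_left ht.1))
  have dL : ∀ (k : ℝ → S → ℝ) (k' : S → ℝ) (t : ℝ), t ∈ Set.Ioc a b →
      HasDerivWithinAt k k' (Set.Icc a b) t → HasDerivWithinAt k k' (Set.Iic t) t := by
    intro k k' t ht hk
    exact hk.mono_of_mem_nhdsWithin (Filter.mem_of_superset (Icc_mem_nhdsLE ht.1)
      (Set.Icc_subset_Icc_right ht.2))
  rcases h0 with h0 | h0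
  · exact ODE_solution_unique_of_mem_Icc_right (v := fun t v => (Q t).mulVec v) (s := fun _ => Set.univ)
      (fun t ht => hL t (Set.Ico_subset_Icc_self ht)) cf
      (fun t ht => dR _ _ t ht (hf t (Set.Ico_subset_Icc_self ht))) (fun _ _ => trivial) cg
      (fun t ht => dR _ _ t ht (hg t (Set.Ico_subset_Icc_self ht))) (fun _ _ => trivial) h0
  · exact ODE_solution_unique_of_mem_Icc_left (v := fun t v => (Q t).mulVec v) (s := fun _ => Set.univ)
      (fun t ht => hL t (Set.Ioc_subset_Icc_self ht)) cf
      (fun t ht => dL _ _ t ht (hf t (Set.Ioc_subset_Icc_self ht))) (fun _ _ => trivial) cg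
      (fun t ht => dL _ _ t ht (hg t (Set.Ioc_subset_Icc_self ht))) (fun _ _ => trivial) h0

section
attribute [local instance] Matrix.linftyOpNormedRing Matrix.linftyOpNormedAlgebra

theorem aux_inv {S : Type*} [Fintype S] [DecidableEq S] (A : ℝ → Matrix S S ℝ)
    (A' : Matrix S S ℝ) (s : Set ℝ) (t : ℝ)
    (hA : ∀ y x, HasDerivWithinAt (fun u => A u y x) (A' y x) s t) (hu : IsUnit (A t)) (y x : S) :
    HasDerivWithinAt (fun u => (A u)⁻¹ y x) ((-((A t)⁻¹ * A' * (A t)⁻¹)) y x) s t := by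
  have h1 : HasDerivWithinAt A A' s t := by
    have : HasDerivWithinAt (fun u => ∑ i, ∑ j, A u i j • Matrix.single i j (1:ℝ))
        (∑ i, ∑ j, A' i j • Matrix.single i j (1:ℝ)) s t :=
      HasDerivWithinAt.fun_sum fun i _ => HasDerivWithinAt.fun_sum fun j _ => (hA i j).smul_const _
    convert this using 1
    · funext u
      conv_lhs => rw [Matrix.matrix_eq_sum_single (A u)]
      simp [Matrix.smul_single]
    · conv_lhs => rw [Matrix.matrix_eq_sum_single A']
      simp [Matrix.smul_single]
  obtain ⟨U, hU⟩ := hu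
  have h2 := hasFDerivAt_ringInverse (𝕜 := ℝ) U
  rw [hU] at h2
  have h3 := h2.comp_hasDerivWithinAt t h1
  have h4 := (LinearMap.toContinuousLinearMap
    (Matrix.entryLinearMap ℝ ℝ y x)).hasFDerivAt.comp_hasDerivWithinAt t h3
  have e : (↑U⁻¹ : Matrix S S ℝ) = (A t)⁻¹ := by rw [← hU, Matrix.coe_units_inv]
  have e1 : (fun u => (A u)⁻¹ y x) = (LinearMap.toContinuousLinearMap
      (Matrix.entryLinearMap ℝ ℝ y x)) ∘ Ring.inverse ∘ A := by
    funext u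
    simp [Matrix.nonsing_inv_eq_ringInverse]
  have e2 : (-((A t)⁻¹ * A' * (A t)⁻¹)) y x = (LinearMap.toContinuousLinearMap
      (Matrix.entryLinearMap ℝ ℝ y x))
      ((-((ContinuousLinearMap.mulLeftRight ℝ (Matrix S S ℝ)) ↑U⁻¹) ↑U⁻¹) A') := by
    rw [e]; simp
  rw [e1, e2]
  exact h4
end

/-- **Doob-transformed CTMC samples the reward-tilted terminal distribution.**
With `h_t(x) = Σ_y exp(r(y))·P(t,T)_{y,x}`, the tilted generators
`Q*(t)_{y,x} = Q(t)_{y,x}·h_t(y)/h_t(x)` (for `y ≠ x`, diagonal fixed so columns sum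
to zero), and `q*` solving `d q*_t/dt = Q*(t) q*_t` from `q*_0 = e_{z₀}`, the terminal
distribution is `q*_T(y) = exp(r(y))·P(0,T)_{y,z₀} / Σ_{y'} exp(r(y'))·P(0,T)_{y',z₀}`. -/
theorem doob_transformed_ctmc_terminal_is_tilted
    {S : Type*} [Fintype S] [DecidableEq S]
    (T : ℝ) (hT : 0 < T)
    (Q : ℝ → Matrix S S ℝ)
    (hQcont : ∀ y x, ContinuousOn (fun t => Q t y x) (Set.Icc 0 T))
    (hQpos : ∀ t ∈ Set.Icc (0 : ℝ) T, ∀ y x, y ≠ x → 0 ≤ Q t y x)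
    (hQsum : ∀ t ∈ Set.Icc (0 : ℝ) T, ∀ x, ∑ y, Q t y x = 0)
    (P : ℝ → ℝ → Matrix S S ℝ)
    (hPinit : ∀ s ∈ Set.Icc (0 : ℝ) T, P s s = 1)
    (hPderiv : ∀ s ∈ Set.Icc (0 : ℝ) T, ∀ t ∈ Set.Icc s T, ∀ x : S,
      HasDerivWithinAt (fun u => (fun y => P s u y x))
        ((Q t).mulVec (fun y => P s t y x)) (Set.Icc s T) t)
    (hPprob : ∀ s ∈ Set.Icc (0 : ℝ) T, ∀ t ∈ Set.Icc s T, ∀ x : S,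
      (∀ y, 0 ≤ P s t y x) ∧ ∑ y, P s t y x = 1)
    (r : S → ℝ)
    (h : ℝ → S → ℝ)
    (hh : ∀ t x, h t x = ∑ y, Real.exp (r y) * P t T y x)
    (Qstar : ℝ → Matrix S S ℝ)
    (hQstarOff : ∀ t ∈ Set.Icc (0 : ℝ) T, ∀ y x, y ≠ x →
      Qstar t y x = Q t y x * h t y / h t x)
    (hQstarDiag : ∀ t ∈ Set.Icc (0 : ℝ) T, ∀ x,
      Qstar t x x = -∑ y ∈ Finset.univ.erase x, Qstar t y x)
    (z0 : S)
    (qstar : ℝ → S → ℝ)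
    (hq0 : qstar 0 = fun y => if y = z0 then (1 : ℝ) else 0)
    (hqderiv : ∀ t ∈ Set.Icc (0 : ℝ) T,
      HasDerivWithinAt qstar ((Qstar t).mulVec (qstar t)) (Set.Icc 0 T) t) :
    ∀ y, qstar T y
      = Real.exp (r y) * P 0 T y z0 / ∑ y', Real.exp (r y') * P 0 T y' z0 := by
  have h0T : (0:ℝ) ∈ Set.Icc (0:ℝ) T := ⟨le_rfl, hT.le⟩
  have hTT : T ∈ Set.Icc (0:ℝ) T := ⟨hT.le, le_rfl⟩
  -- solutions from P
  have hPv : ∀ s ∈ Set.Icc (0:ℝ) T, ∀ v : S → ℝ, ∀ t ∈ Set.Icc s T,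
      HasDerivWithinAt (fun u => (P s u).mulVec v) ((Q t).mulVec ((P s t).mulVec v))
        (Set.Icc s T) t := by
    intro s hs v t ht
    have : HasDerivWithinAt (fun u => ∑ x, v x • (fun y => P s u y x))
        (∑ x, v x • (Q t).mulVec (fun y => P s t y x)) (Set.Icc s T) t :=
      HasDerivWithinAt.fun_sum fun x _ => (hPderiv s hs t ht x).const_smul (v x)
    convert this using 1
    · funext u y
      simp [Matrix.mulVec, dotProduct, mul_comm]
    · rw [Matrix.mulVec_mulVec]
      funext y
      simp [Matrix.mulVec, dotProduct, Matrix.mul_apply, mul_comm]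
  have hCK : ∀ s ∈ Set.Icc (0:ℝ) T, P s T * P 0 s = P 0 T := by
    intro s hs
    have key : ∀ v : S → ℝ, (P s T * P 0 s).mulVec v = (P 0 T).mulVec v := by
      intro v
      rw [← Matrix.mulVec_mulVec]
      refine aux_unique T Q hQcont s T hs.1 le_rfl (fun u => (P s u).mulVec ((P 0 s).mulVec v))
        (fun u => (P 0 u).mulVec v) (hPv s hs _) (fun t ht => ?_) (Or.inl ?_) T ⟨hs.2, le_rfl⟩
      · exact (hPv 0 h0T v t ⟨hs.1.trans ht.1, ht.2⟩).mono (Set.Icc_subset_Icc_left hs.1)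
      · simp [hPinit s hs]
    exact Matrix.mulVec_injective (funext key)
  have hunit : ∀ t ∈ Set.Icc (0:ℝ) T, IsUnit (P 0 t) := by
    intro t ht
    rw [← Matrix.mulVec_injective_iff_isUnit]
    intro v w hvw
    have := aux_unique T Q hQcont 0 t le_rfl ht.2 (fun u => (P 0 u).mulVec v)
      (fun u => (P 0 u).mulVec w)
      (fun s hs => (hPv 0 h0T v s ⟨hs.1, hs.2.trans ht.2⟩).mono (Set.Icc_subset_Icc_right ht.2))
      (fun s hs => (hPv 0 h0T w s ⟨hs.1, hs.2.trans ht.2⟩).mono (Set.Icc_subset_Icc_right ht.2))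
      (Or.inr hvw) 0 ⟨le_rfl, ht.1⟩
    simpa [hPinit 0 h0T] using this
  have hPsT : ∀ t ∈ Set.Icc (0:ℝ) T, P t T = P 0 T * (P 0 t)⁻¹ := by
    intro t ht
    rw [← hCK t ht, Matrix.mul_assoc, Matrix.mul_nonsing_inv _ ((Matrix.isUnit_iff_isUnit_det _).1 (hunit t ht)), Matrix.mul_one]
  have hhv : ∀ t, h t = Matrix.vecMul (fun y => Real.exp (r y)) (P t T) := by
    intro t; funext x; rw [hh]; rfl
  have hhv' : ∀ t ∈ Set.Icc (0:ℝ) T, h t = Matrix.vecMul (h 0) (P 0 t)⁻¹ := by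
    intro t ht
    rw [hhv, hhv, Matrix.vecMul_vecMul, hPsT t ht]
  have hhd : ∀ t ∈ Set.Icc (0:ℝ) T, ∀ x, HasDerivWithinAt (fun u => h u x)
      (-(Matrix.vecMul (h t) (Q t) x)) (Set.Icc 0 T) t := by
    intro t ht x
    have hinv := fun y => aux_inv (P 0) (Q t * P 0 t) (Set.Icc 0 T) t
      (fun y x => by
        have := (hasDerivWithinAt_pi.1 (hPderiv 0 h0T t ht x)) y
        exact this) (hunit t ht) y x
    have hs : HasDerivWithinAt (fun u => ∑ y, h 0 y * (P 0 u)⁻¹ y x)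
      (∑ y, h 0 y * (-((P 0 t)⁻¹ * (Q t * P 0 t) * (P 0 t)⁻¹)) y x) (Set.Icc 0 T) t :=
      HasDerivWithinAt.fun_sum fun y _ => (hinv y).const_mul (h 0 y)
    have e : (P 0 t)⁻¹ * (Q t * P 0 t) * (P 0 t)⁻¹ = (P 0 t)⁻¹ * Q t := by
      rw [Matrix.mul_assoc, Matrix.mul_assoc, Matrix.mul_nonsing_inv _ ((Matrix.isUnit_iff_isUnit_det _).1 (hunit t ht)), Matrix.mul_one]
    have e2 : (∑ y, h 0 y * (-((P 0 t)⁻¹ * (Q t * P 0 t) * (P 0 t)⁻¹)) y x)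
        = -(Matrix.vecMul (h t) (Q t) x) := by
      rw [hhv' t ht, Matrix.vecMul_vecMul, e]
      simp [Matrix.vecMul, dotProduct]
    rw [e2] at hs
    refine hs.congr_of_mem (fun u hu => ?_) ht
    rw [hhv' u hu]; rfl
  have hpos : ∀ t ∈ Set.Icc (0:ℝ) T, ∀ x, 0 < h t x := by
    intro t ht x
    obtain ⟨h1, h2⟩ := hPprob t ht T ⟨ht.2, le_rfl⟩ x
    rw [hh]
    obtain ⟨y, hy, hy'⟩ := Finset.exists_ne_zero_of_sum_ne_zero (h2 ▸ one_ne_zero : ∑ y, P t T y x ≠ 0)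
    exact Finset.sum_pos' (fun y _ => mul_nonneg (Real.exp_pos _).le (h1 y))
      ⟨y, hy, mul_pos (Real.exp_pos _) (lt_of_le_of_ne (h1 y) (Ne.symm hy'))⟩
  have hw := aux_unique T Q hQcont 0 T le_rfl le_rfl (fun u y => qstar u y / h u y)
    (fun u => (P 0 u).mulVec (fun y => qstar 0 y / h 0 y)) (fun t ht => ?_) (hPv 0 h0T _)
    (Or.inl (by simp [hPinit 0 h0T])) T hTT
  · intro y
    have hy := congrFun hw y
    have e1 : h T y = Real.exp (r y) := by
      rw [hh, hPinit T hTT]; simp [Matrix.one_apply]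
    rw [← hh 0 z0]
    simp only [hq0, Matrix.mulVec, dotProduct] at hy
    rw [Finset.sum_eq_single z0 (by intro b _ hb; simp [hb]) (by simp)] at hy
    rw [div_eq_iff (hpos T hTT y).ne', e1] at hy
    rw [hy]; simp; ring
  · rw [hasDerivWithinAt_pi]
    intro y
    have d := ((hasDerivWithinAt_pi.1 (hqderiv t ht)) y).fun_div (hhd t ht y) (hpos t ht y).ne'
    refine HasDerivWithinAt.congr_deriv d ?_
    symm
    have hp := fun x => (hpos t ht x).ne'
    have a1 : (Qstar t).mulVec (qstar t) y = Qstar t y y * qstar t y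
        + ∑ x ∈ Finset.univ.erase y, Qstar t y x * qstar t x := by
      rw [Finset.add_sum_erase _ (fun x => Qstar t y x * qstar t x) (Finset.mem_univ y)]; rfl
    have a2 : (Q t).mulVec (fun y => qstar t y / h t y) y = Q t y y * (qstar t y / h t y)
        + ∑ x ∈ Finset.univ.erase y, Q t y x * (qstar t x / h t x) := by
      rw [Finset.add_sum_erase _ (fun x => Q t y x * (qstar t x / h t x)) (Finset.mem_univ y)]; rfl
    have a3 : Matrix.vecMul (h t) (Q t) y = h t y * Q t y y
        + ∑ x ∈ Finset.univ.erase y, h t x * Q t x y := by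
      rw [Finset.add_sum_erase _ (fun x => h t x * Q t x y) (Finset.mem_univ y)]; rfl
    have a4 : ∑ x ∈ Finset.univ.erase y, Qstar t y x * qstar t x
        = h t y * ∑ x ∈ Finset.univ.erase y, Q t y x * (qstar t x / h t x) := by
      rw [Finset.mul_sum]
      refine Finset.sum_congr rfl fun x hx => ?_
      rw [hQstarOff t ht y x (Finset.ne_of_mem_erase hx).symm]
      ring
    have a5 : Qstar t y y = -((∑ x ∈ Finset.univ.erase y, h t x * Q t x y) / h t y) := by
      rw [hQstarDiag t ht y, Finset.sum_div]
      congr 1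
      refine Finset.sum_congr rfl fun x hx => ?_
      rw [hQstarOff t ht x y (Finset.ne_of_mem_erase hx)]
      ring
    rw [a1, a2, a3, a4, a5]
    have := hp y
    field_simp
    ring
end

section
/- Let (α_s)_{s≥1} be reals with 0 < α_s < 1 for all s, and define for each s the Gaussian transition kernel on ℝ given by κ_s(x) = N(√α_s · x, 1 − α_s) (Gaussian measure on ℝ with mean √α_s·x and variance 1 − α_s). Then for every t ≥ 1 and every x₀ ∈ ℝ, the law of x_t under the forward chain x_s ∼ κ_s(x_{s−1}) started at x₀ (i.e. the t-fold composition of the kernels applied to the point mass at x₀) is the Gaussian measure N(√ᾱ_t · x₀, 1 − ᾱ_t), where ᾱ_t = Π_{i=1}^{t} α_i. -/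
open MeasureTheory ProbabilityTheory

/-- The law of the forward Gaussian chain `x_s ∼ N(√α_s · x_{s-1}, 1 − α_s)` at time
`t`, started at the point mass at `x0`. -/
noncomputable def gaussChain (α : ℕ → ℝ) (x0 : ℝ) : ℕ → Measure ℝ
  | 0 => Measure.dirac x0
  | (t + 1) => (gaussChain α x0 t).bind
      (fun x => gaussianReal (Real.sqrt (α (t + 1)) * x) (Real.toNNReal (1 - α (t + 1))))

lemma gaussian_bind_affine (m c : ℝ) (v w : NNReal) :
    (gaussianReal m v).bind (fun x => gaussianReal (c * x) w)
      = gaussianReal (c * m) (NNReal.mk (c ^ 2) (sq_nonneg c) * v + w) := by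
  have hm : Measurable (fun x : ℝ => gaussianReal (c * x) w) :=
    measurable_gaussianReal.comp (by fun_prop : Measurable fun x : ℝ => (c * x, w))
  have h := gaussianReal_conv_gaussianReal (m₁ := c * m) (m₂ := 0)
    (v₁ := NNReal.mk (c ^ 2) (sq_nonneg c) * v) (v₂ := w)
  rw [add_zero] at h
  rw [← h, ← gaussianReal_map_const_mul c]
  ext s hs
  rw [Measure.bind_apply hs hm.aemeasurable, ← lintegral_indicator_one hs,
    Measure.lintegral_conv (measurable_one.indicator hs), lintegral_map _ (by fun_prop)]
  · refine lintegral_congr fun x => ?_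
    rw [← lintegral_map (f := s.indicator 1) (g := fun y => c * x + y)
      (measurable_one.indicator hs) (by fun_prop), gaussianReal_map_const_add,
      lintegral_indicator_one hs, zero_add]
  · exact Measurable.lintegral_prod_right'
      (f := fun p : ℝ × ℝ => s.indicator (1 : ℝ → ENNReal) (p.1 + p.2))
      ((measurable_one.indicator hs).comp (by fun_prop))

theorem gaussian_forward_chain_law
    (α : ℕ → ℝ) (hα : ∀ s, 0 < α s ∧ α s < 1) :
    ∀ t, 1 ≤ t → ∀ x0 : ℝ,
      gaussChain α x0 t
        = gaussianReal (Real.sqrt (∏ i ∈ Finset.Icc 1 t, α i) * x0)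
            (Real.toNNReal (1 - ∏ i ∈ Finset.Icc 1 t, α i)) := by
  intro t _ x0
  induction t with
  | zero => omega
  | succ t ih =>
    have ih' : gaussChain α x0 t
        = gaussianReal (Real.sqrt (∏ i ∈ Finset.Icc 1 t, α i) * x0)
            (Real.toNNReal (1 - ∏ i ∈ Finset.Icc 1 t, α i)) := by
      rcases Nat.eq_zero_or_pos t with rfl | ht
      · simp [gaussChain]
      · exact ih ht
    have h0 : 0 ≤ ∏ i ∈ Finset.Icc 1 t, α i := Finset.prod_nonneg fun i _ => (hα i).1.le
    have h1 : ∏ i ∈ Finset.Icc 1 t, α i ≤ 1 :=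
      Finset.prod_le_one (fun i _ => (hα i).1.le) fun i _ => (hα i).2.le
    obtain ⟨ha, hb⟩ := hα (t + 1)
    rw [gaussChain, ih', gaussian_bind_affine, Finset.prod_Icc_succ_top (by omega)]
    generalize ∏ i ∈ Finset.Icc 1 t, α i = P at *
    have hab : P * α (t + 1) ≤ 1 := mul_le_one₀ h1 ha.le hb.le
    congr 1
    · rw [Real.sqrt_mul h0]; ring
    · apply NNReal.eq
      push_cast
      rw [Real.coe_toNNReal _ (by linarith), Real.coe_toNNReal _ (by linarith),
        Real.coe_toNNReal _ (by linarith)]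
      simp only [NNReal.coe_mk, Real.sq_sqrt ha.le]
      ring
end
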